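/- arXiv:2205.13094 — 2 statements merged into one kernel-verified Lean document; each statement's English description precedes it below -/
import Mathlib

section
/- For the hard label-shift family: if V is drawn uniformly from V = {−1,0,1}^K × {−1,0,1}^K and S | V=v is drawn from P_{v,maj}^{n_maj} × P_{v,min}^{n_min}, then E_{S ~ Q_S}[ TV( Σ_{v∈V} Q(v|S)·P_{v,1}, Σ_{v∈V} Q(v|S)·P_{v,−1} ) ] ≤ 1/(18K) − (1/(144K))·exp(−n_min/(3K³)). -/
open MeasureTheory Set
open scoped ENNReal Classical

noncomputable section

/-! ## Basic setup: distributions on `ℝ × Bool`, risk, excess risk.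

A labelled example is a pair `(x, y) : ℝ × Bool`, where the label `true` codes `+1`
and `false` codes `-1`; features are supported on `[0,1]`. -/

/-- The risk (probability of misclassification) of a classifier `f : ℝ → Bool`
under a distribution `P` on `ℝ × Bool`. -/
def risk (f : ℝ → Bool) (P : Measure (ℝ × Bool)) : ℝ :=
  (P {p : ℝ × Bool | f p.1 ≠ p.2}).toReal

/-- The Bayes risk of a distribution: the infimum of the risk over all classifiers. -/
def bayesRisk (P : Measure (ℝ × Bool)) : ℝ :=
  ⨅ f : ℝ → Bool, risk f P

/-- The balanced test distribution `P_test = (1/2) P_maj + (1/2) P_min`. -/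
def testMeasure (Pmaj Pmin : Measure (ℝ × Bool)) : Measure (ℝ × Bool) :=
  (2 : ℝ≥0∞)⁻¹ • Pmaj + (2 : ℝ≥0∞)⁻¹ • Pmin

/-- A training sample: `nmaj` labelled points from the majority distribution and
`nmin` labelled points from the minority distribution. -/
abbrev Sample (nmaj nmin : ℕ) : Type :=
  (Fin nmaj → ℝ × Bool) × (Fin nmin → ℝ × Bool)

/-- The law `P_maj^{n_maj} × P_min^{n_min}` of the training sample. -/
def sampleMeasure (nmaj nmin : ℕ) (Pmaj Pmin : Measure (ℝ × Bool)) :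
    Measure (Sample nmaj nmin) :=
  (Measure.pi fun _ : Fin nmaj => Pmaj).prod (Measure.pi fun _ : Fin nmin => Pmin)

/-- An algorithm (a map from samples to classifiers) is measurable if the joint map
`(S, x) ↦ A S x` is measurable. -/
def MeasurableAlg (nmaj nmin : ℕ) (A : Sample nmaj nmin → ℝ → Bool) : Prop :=
  Measurable fun p : Sample nmaj nmin × ℝ => A p.1 p.2

/-- The expected excess risk of the algorithm `A` on the pair `(P_maj, P_min)`:
`E_{S ~ P_maj^{n_maj} × P_min^{n_min}}[R(A^S; P_test)] - R(f^*; P_test)`. -/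
def excessRisk (nmaj nmin : ℕ) (A : Sample nmaj nmin → ℝ → Bool)
    (Pmaj Pmin : Measure (ℝ × Bool)) : ℝ :=
  (∫ S, risk (A S) (testMeasure Pmaj Pmin) ∂sampleMeasure nmaj nmin Pmaj Pmin)
    - bayesRisk (testMeasure Pmaj Pmin)

/-- The distribution on `ℝ × Bool` supported on label `y` whose feature has density `p`
(w.r.t. Lebesgue measure) on `[0,1]`. -/
def labelMeasure (p : ℝ → ℝ) (y : Bool) : Measure (ℝ × Bool) :=
  Measure.map (fun x => (x, y))
    ((volume.restrict (Icc (0:ℝ) 1)).withDensity fun x => ENNReal.ofReal (p x))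

/-- The label-shift class `𝒫_LS`: `P_maj(x,y) = P₁(x)·1{y = 1}`,
`P_min(x,y) = P₋₁(x)·1{y = -1}` with `P₁, P₋₁` 1-Lipschitz densities on `[0,1]`. -/
def memLS (Pmaj Pmin : Measure (ℝ × Bool)) : Prop :=
  ∃ p1 pm1 : ℝ → ℝ,
    (∀ x, 0 ≤ p1 x) ∧ (∀ x, 0 ≤ pm1 x) ∧
    LipschitzOnWith 1 p1 (Icc 0 1) ∧ LipschitzOnWith 1 pm1 (Icc 0 1) ∧
    (∫ x in Icc (0:ℝ) 1, p1 x) = 1 ∧ (∫ x in Icc (0:ℝ) 1, pm1 x) = 1 ∧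
    Pmaj = labelMeasure p1 true ∧ Pmin = labelMeasure pm1 false

/-- Total variation distance between two densities on `[0,1]`:
`TV(p, q) = (1/2)∫₀¹ |p - q|`. -/
def tvDist (p q : ℝ → ℝ) : ℝ :=
  (1/2) * ∫ x in Icc (0:ℝ) 1, |p x - q x|

/-- The distribution on `ℝ × Bool` whose feature has density `p` on `[0,1]` and whose
label is `true` with probability `η x` conditionally on the feature `x`. -/
def covMeasure (p η : ℝ → ℝ) : Measure (ℝ × Bool) :=
  labelMeasure (fun x => p x * η x) true + labelMeasure (fun x => p x * (1 - η x)) false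

/-- The group-covariate shift class `𝒫_GS(τ)`: `P_maj(x,y) = P_a(x)·P(y|x)`,
`P_min(x,y) = P_b(x)·P(y|x)` with group densities `P_a, P_b` on `[0,1]`,
a shared 1-Lipschitz conditional label distribution, and overlap
`1 - TV(P_a, P_b) ≥ τ`. -/
def memGS (τ : ℝ) (Pmaj Pmin : Measure (ℝ × Bool)) : Prop :=
  ∃ pa pb η : ℝ → ℝ,
    (∀ x, 0 ≤ pa x) ∧ (∀ x, 0 ≤ pb x) ∧
    (∫ x in Icc (0:ℝ) 1, pa x) = 1 ∧ (∫ x in Icc (0:ℝ) 1, pb x) = 1 ∧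
    (∀ x, 0 ≤ η x ∧ η x ≤ 1) ∧
    LipschitzOnWith 1 η (Icc 0 1) ∧ LipschitzOnWith 1 (fun x => 1 - η x) (Icc 0 1) ∧
    τ ≤ 1 - tvDist pa pb ∧
    Pmaj = covMeasure pa η ∧ Pmin = covMeasure pb η

/-! ## The hat function -/

/-- The hat function `φ_K`. -/
def hatFun (K : ℕ) (x : ℝ) : ℝ :=
  if x ∈ Icc (-(1/(2*(K:ℝ)))) 0 then |x + 1/(4*(K:ℝ))| - 1/(4*(K:ℝ))
  else if x ∈ Icc (0:ℝ) (1/(2*(K:ℝ))) then 1/(4*(K:ℝ)) - |x - 1/(4*(K:ℝ))|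
  else 0

/-! ## The hard family for the label-shift lower bound.

Bins are 0-indexed: `I_j = [j/K, (j+1)/K)` for `j = 0, …, K-1`, corresponding to the
paper's `I_{j+1} = [((j+1)-1)/K, (j+1)/K]`; the bin center is `(j + 1/2)/K`. -/

/-- The value in `{-1, 0, 1}` coded by an element of `Fin 3`. -/
def trit (i : Fin 3) : ℝ := (i : ℝ) - 1

/-- The perturbed density of the hard label-shift family: on the bin
`I_j = [j/K, (j+1)/K)` it equals `1 + v_j · φ_K(x - (j + 1/2)/K)`. -/
def hardDensityLS (K : ℕ) (v : Fin K → Fin 3) (x : ℝ) : ℝ :=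
  1 + ∑ j : Fin K,
    (if x ∈ Ico ((j:ℝ)/(K:ℝ)) (((j:ℝ)+1)/(K:ℝ))
      then trit (v j) * hatFun K (x - ((j:ℝ) + 1/2)/(K:ℝ)) else 0)

/-- The index set `𝒱 = {-1,0,1}^K × {-1,0,1}^K` of the hard label-shift family. -/
abbrev TritPair (K : ℕ) : Type := (Fin K → Fin 3) × (Fin K → Fin 3)

/-- The law `Q(S | v) = P_{v,maj}^{n_maj} × P_{v,min}^{n_min}` of the sample for the hard
label-shift instance indexed by `v`. -/
def hardLSMeasure (K nmaj nmin : ℕ) (v : TritPair K) : Measure (Sample nmaj nmin) :=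
  sampleMeasure nmaj nmin (labelMeasure (hardDensityLS K v.1) true)
    (labelMeasure (hardDensityLS K v.2) false)

/-- The marginal law `Q_S` of the sample when the index `V` is uniform on `𝒱`. -/
def hardLSMarginal (K nmaj nmin : ℕ) : Measure (Sample nmaj nmin) :=
  ∑ v : TritPair K, (Fintype.card (TritPair K) : ℝ≥0∞)⁻¹ • hardLSMeasure K nmaj nmin v

/-- The posterior weight `Q(v | S)`: the Radon–Nikodym derivative of
`(1/|𝒱|) · Q(S | v)` with respect to `Q_S`, evaluated at `S`. -/
def postLS (K nmaj nmin : ℕ) (v : TritPair K) (S : Sample nmaj nmin) : ℝ :=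
  (((Fintype.card (TritPair K) : ℝ≥0∞)⁻¹ • hardLSMeasure K nmaj nmin v).rnDeriv
      (hardLSMarginal K nmaj nmin) S).toReal

/-- The posterior mixture density `Σ_{v ∈ 𝒱} Q(v | S) · P_{v, ±1}`;
`cls = true` selects the class `+1` densities `P_{v,1}`. -/
def postMixLS (K nmaj nmin : ℕ) (S : Sample nmaj nmin) (cls : Bool) (x : ℝ) : ℝ :=
  ∑ v : TritPair K,
    postLS K nmaj nmin v S * hardDensityLS K (if cls then v.1 else v.2) x

/-! ## The hard family for the group-covariate shift lower bound -/

/-- The sign `+1` / `-1` coded by a Bool. -/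
def sgnB (b : Bool) : ℝ := if b then 1 else -1

/-- `P_v(y = 1 | x)` for the hard group-shift family: on the bin `I_j = [j/K, (j+1)/K)` it
equals `(1/2)(1 + v_j · φ_K(x - (j+1/2)/K))`. -/
def hardEta (K : ℕ) (v : Fin K → Bool) (x : ℝ) : ℝ :=
  (1/2) * (1 + ∑ j : Fin K,
    (if x ∈ Ico ((j:ℝ)/(K:ℝ)) (((j:ℝ)+1)/(K:ℝ))
      then sgnB (v j) * hatFun K (x - ((j:ℝ) + 1/2)/(K:ℝ)) else 0))

/-- The majority-group feature density: `2 - τ` on `[0, 1/2)` and `τ` on `[1/2, 1]`. -/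
def hardPa (τ : ℝ) (x : ℝ) : ℝ := if x < 1/2 then 2 - τ else τ

/-- The minority-group feature density `P_b = 2 - P_a`. -/
def hardPb (τ : ℝ) (x : ℝ) : ℝ := 2 - hardPa τ x

/-- The law `Q(S | v)` of the sample for the hard group-shift instance indexed by `v`. -/
def hardGSMeasure (K nmaj nmin : ℕ) (τ : ℝ) (v : Fin K → Bool) :
    Measure (Sample nmaj nmin) :=
  sampleMeasure nmaj nmin (covMeasure (hardPa τ) (hardEta K v))
    (covMeasure (hardPb τ) (hardEta K v))

/-- The conditional law `Q(S | v_j = b)` of the sample given the `j`-th coordinate of the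
uniformly random index: the uniform mixture over all `v` with `v_j = b`. -/
def condGS (K nmaj nmin : ℕ) (τ : ℝ) (j : Fin K) (b : Bool) :
    Measure (Sample nmaj nmin) :=
  ((Finset.univ.filter fun v : Fin K → Bool => v j = b).card : ℝ≥0∞)⁻¹ •
    ∑ v ∈ Finset.univ.filter (fun v : Fin K → Bool => v j = b),
      hardGSMeasure K nmaj nmin τ v

/-- The Kullback–Leibler divergence `KL(μ ‖ ν) = ∫ log (dμ/dν) dμ`. -/
def klDiv' {α : Type*} [MeasurableSpace α] (μ ν : Measure α) : ℝ :=
  ∫ x, Real.log ((μ.rnDeriv ν x).toReal) ∂μ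

/-! ## The undersampled binning estimator -/

/-- The prediction of the undersampled binning estimator on the bin `I_j = [j/K, (j+1)/K)`
(0-indexed), where `s ⊆ Fin nmaj` is the set of retained majority samples: predict `+1`
iff the samples of the undersampled dataset in the bin with label `+1` strictly
outnumber those with label `-1`. -/
def usbBinPred (nmaj nmin K : ℕ) (s : Finset (Fin nmaj)) (S : Sample nmaj nmin)
    (j : ℕ) : Bool :=
  decide
    ((s.filter fun i => (S.1 i).2 = false ∧
        (S.1 i).1 ∈ Ico ((j:ℝ)/(K:ℝ)) (((j:ℝ)+1)/(K:ℝ))).card +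
      (Finset.univ.filter fun i : Fin nmin => (S.2 i).2 = false ∧
        (S.2 i).1 ∈ Ico ((j:ℝ)/(K:ℝ)) (((j:ℝ)+1)/(K:ℝ))).card
      <
      (s.filter fun i => (S.1 i).2 = true ∧
        (S.1 i).1 ∈ Ico ((j:ℝ)/(K:ℝ)) (((j:ℝ)+1)/(K:ℝ))).card +
      (Finset.univ.filter fun i : Fin nmin => (S.2 i).2 = true ∧
        (S.2 i).1 ∈ Ico ((j:ℝ)/(K:ℝ)) (((j:ℝ)+1)/(K:ℝ))).card)

/-- The undersampled binning classifier `A_USB^{S,K}` with `K` bins, given the retained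
majority samples `s`: on each bin it predicts the majority label among the undersampled
data in that bin. -/
def usbClassifier (nmaj nmin K : ℕ) (s : Finset (Fin nmaj)) (S : Sample nmaj nmin) :
    ℝ → Bool :=
  fun x => usbBinPred nmaj nmin K s S (min ⌊x * (K:ℝ)⌋₊ (K - 1))

/-- The expected excess risk of the undersampled binning estimator with `K` bins, where the
`nmin` retained majority samples are drawn uniformly at random without replacement
(uniformly among all subsets of size `nmin`). -/
def usbExcessRisk (nmaj nmin K : ℕ) (Pmaj Pmin : Measure (ℝ × Bool)) : ℝ :=
  (∑ s ∈ Finset.powersetCard nmin (Finset.univ : Finset (Fin nmaj)),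
      ∫ S, risk (usbClassifier nmaj nmin K s S) (testMeasure Pmaj Pmin)
        ∂sampleMeasure nmaj nmin Pmaj Pmin)
    / ((Finset.powersetCard nmin (Finset.univ : Finset (Fin nmaj))).card : ℝ)
  - bayesRisk (testMeasure Pmaj Pmin)

/-- `q_{j,y} = P(y | x ∈ I_j)` for the 0-indexed bin `I_j = [j/K, (j+1)/K)`. -/
def qBin (P : Measure (ℝ × Bool)) (K j : ℕ) (y : Bool) : ℝ :=
  (P ((Ico ((j:ℝ)/(K:ℝ)) (((j:ℝ)+1)/(K:ℝ))) ×ˢ ({y} : Set Bool))).toReal /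
    (P ((Ico ((j:ℝ)/(K:ℝ)) (((j:ℝ)+1)/(K:ℝ))) ×ˢ (univ : Set Bool))).toReal

/-- The excess risk of the binning estimator in the bin `I_j`:
`R_j(A_USB^S) = q_{j, -A_j^S} - min{q_{j,1}, q_{j,-1}}`. -/
def binExcess (nmaj nmin K : ℕ) (s : Finset (Fin nmaj)) (S : Sample nmaj nmin)
    (P : Measure (ℝ × Bool)) (j : ℕ) : ℝ :=
  qBin P K j (!(usbBinPred nmaj nmin K s S j)) - min (qBin P K j true) (qBin P K j false)

/-- The binomial probability mass function `P[Bin(m, p) = k]`. -/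
def binomPMF (m : ℕ) (p : ℝ) (k : ℕ) : ℝ :=
  (m.choose k : ℝ) * p ^ k * (1 - p) ^ (m - k)

/-! ## The hat function: symmetry, size and integrals -/

lemma hatFun_of_mem_Icc_zero {K : ℕ} (hK : 0 < K) {x : ℝ} (hx : x ∈ Icc (0:ℝ) (1/(2*(K:ℝ)))) :
    hatFun K x = 1/(4*(K:ℝ)) - |x - 1/(4*(K:ℝ))| := by
  have hK' : (0:ℝ) < 1/(4*(K:ℝ)) := by positivity
  unfold hatFun
  split_ifs with h
  · obtain rfl : x = 0 := le_antisymm h.2 hx.1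
    rw [zero_add, zero_sub, abs_neg, abs_of_pos hK', sub_self]
  · rfl

lemma hatFun_neg {K : ℕ} (hK : 0 < K) (x : ℝ) : hatFun K (-x) = -hatFun K x := by
  have key : ∀ y : ℝ, 0 ≤ y → hatFun K (-y) = -hatFun K y := by
    intro y hy
    by_cases hy2 : y ≤ 1/(2*(K:ℝ))
    · rw [hatFun_of_mem_Icc_zero hK ⟨hy, hy2⟩]
      unfold hatFun
      rw [if_pos ⟨by linarith, by linarith⟩, ← abs_neg (-y + _)]
      ring_nf
    · have hp : (0:ℝ) < 1/(2*(K:ℝ)) := by positivity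
      unfold hatFun
      rw [if_neg fun h => hy2 (by linarith [h.1]), if_neg fun h => hy2 (by linarith [h.1]),
        if_neg fun h => hy2 (by linarith [h.2]), if_neg fun h => hy2 h.2, neg_zero]
  rcases le_total 0 x with h | h
  · exact key x h
  · have := key (-x) (by linarith)
    rw [neg_neg] at this
    linarith

lemma hatFun_nonneg {K : ℕ} (hK : 0 < K) {x : ℝ} (hx : x ∈ Icc (0:ℝ) (1/(2*(K:ℝ)))) :
    0 ≤ hatFun K x := by
  have h2 : 1/(2*(K:ℝ)) = 2 * (1/(4*(K:ℝ))) := by field_simp; norm_num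
  rw [hatFun_of_mem_Icc_zero hK hx, sub_nonneg, abs_le]
  constructor <;> linarith [hx.1, hx.2]

lemma abs_hatFun_le {K : ℕ} (hK : 0 < K) (x : ℝ) : |hatFun K x| ≤ 1/(4*(K:ℝ)) := by
  have hp : (0:ℝ) < 1/(4*(K:ℝ)) := by positivity
  have h2 : 1/(2*(K:ℝ)) = 2 * (1/(4*(K:ℝ))) := by field_simp; norm_num
  unfold hatFun
  split_ifs with h h'
  · rw [abs_le]
    have : |x + 1/(4*(K:ℝ))| ≤ 1/(4*(K:ℝ)) := by
      rw [abs_le]; constructor <;> linarith [h.1, h.2]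
    constructor <;> linarith [abs_nonneg (x + 1/(4*(K:ℝ)))]
  · rw [abs_le]
    have : |x - 1/(4*(K:ℝ))| ≤ 1/(4*(K:ℝ)) := by
      rw [abs_le]; constructor <;> linarith [h'.1, h'.2]
    constructor <;> linarith [abs_nonneg (x - 1/(4*(K:ℝ)))]
  · simp

lemma measurable_hatFun (K : ℕ) : Measurable (hatFun K) := by
  unfold hatFun
  refine Measurable.ite measurableSet_Icc (by fun_prop) ?_
  exact Measurable.ite measurableSet_Icc (by fun_prop) measurable_const

lemma integral_hatFun {K : ℕ} (hK : 0 < K) :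
    ∫ x in (-(1/(2*(K:ℝ))))..(1/(2*(K:ℝ))), hatFun K x = 0 := by
  have h := intervalIntegral.integral_comp_neg (a := -(1/(2*(K:ℝ)))) (b := 1/(2*(K:ℝ))) (hatFun K)
  simp only [hatFun_neg hK, intervalIntegral.integral_neg, neg_neg] at h
  linarith

lemma integral_abs_symm {a : ℝ} (ha : 0 ≤ a) : ∫ x in (-a)..a, |x| = a ^ 2 := by
  have hi : ∀ b c : ℝ, IntervalIntegrable (fun x : ℝ => |x|) volume b c :=
    fun b c => continuous_abs.intervalIntegrable b c
  have h0 : ∫ x in (0:ℝ)..a, |x| = a ^ 2 / 2 := by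
    rw [intervalIntegral.integral_congr (g := fun x => x), integral_id]
    · ring
    · intro x hx
      rw [uIcc_of_le ha] at hx
      exact abs_of_nonneg hx.1
  have h1 := intervalIntegral.integral_comp_neg (a := 0) (b := a) (fun x : ℝ => |x|)
  simp only [abs_neg, neg_zero] at h1
  rw [← intervalIntegral.integral_add_adjacent_intervals (hi (-a) 0) (hi 0 a), ← h1, h0]
  ring

lemma integral_abs_hatFun {K : ℕ} (hK : 0 < K) :
    ∫ x in (-(1/(2*(K:ℝ))))..(1/(2*(K:ℝ))), |hatFun K x| = 1/(8*(K:ℝ)^2) := by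
  have hp : (0:ℝ) < 1/(4*(K:ℝ)) := by positivity
  have h2 : 1/(2*(K:ℝ)) = 2 * (1/(4*(K:ℝ))) := by field_simp; norm_num
  have hi : ∀ b c : ℝ, IntervalIntegrable (fun x : ℝ => |hatFun K x|) volume b c := by
    intro b c
    refine (intervalIntegrable_const (c := 1/(4*(K:ℝ)))).mono_fun
      (measurable_hatFun K).abs.aestronglyMeasurable (Filter.Eventually.of_forall fun x => ?_)
    simpa [abs_of_pos hp] using abs_hatFun_le hK x
  have h0 : ∫ x in (0:ℝ)..(1/(2*(K:ℝ))), |hatFun K x| = (1/(4*(K:ℝ)))^2 := by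
    rw [intervalIntegral.integral_congr (g := fun x => 1/(4*(K:ℝ)) - |x - 1/(4*(K:ℝ))|)]
    · rw [intervalIntegral.integral_sub (by simp)
        (Continuous.intervalIntegrable (by fun_prop) _ _),
        intervalIntegral.integral_comp_sub_right (fun x => |x|), h2]
      rw [show (0:ℝ) - 1/(4*(K:ℝ)) = -(1/(4*(K:ℝ))) by ring,
        show 2 * (1/(4*(K:ℝ))) - 1/(4*(K:ℝ)) = 1/(4*(K:ℝ)) by ring, integral_abs_symm hp.le,
        intervalIntegral.integral_const, smul_eq_mul]
      ring
    · intro x hx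
      rw [uIcc_of_le (by positivity)] at hx
      simp only [abs_of_nonneg (hatFun_nonneg hK hx)]
      exact hatFun_of_mem_Icc_zero hK hx
  have h1 := intervalIntegral.integral_comp_neg (a := 0) (b := 1/(2*(K:ℝ)))
    (fun x : ℝ => |hatFun K x|)
  simp only [hatFun_neg hK, abs_neg, neg_zero] at h1
  rw [← intervalIntegral.integral_add_adjacent_intervals (hi _ 0) (hi 0 _), ← h1, h0]
  field_simp
  norm_num

/-! ## Bins and bumps -/

/-- The hat function recentred on the `j`-th bin, and zero outside of it. -/
def bump (K : ℕ) (j : Fin K) (x : ℝ) : ℝ :=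
  (Ico ((j:ℝ)/(K:ℝ)) (((j:ℝ)+1)/(K:ℝ))).indicator
    (fun x => hatFun K (x - ((j:ℝ) + 1/2)/(K:ℝ))) x

lemma hardDensityLS_eq (K : ℕ) (v : Fin K → Fin 3) (x : ℝ) :
    hardDensityLS K v x = 1 + ∑ j, trit (v j) * bump K j x := by
  unfold hardDensityLS bump
  congr 1
  refine Finset.sum_congr rfl fun j _ => ?_
  rw [indicator_apply]
  split_ifs <;> simp

lemma setIntegral_indicator_bin {K : ℕ} (j : Fin K) (g : ℝ → ℝ) :
    ∫ x in Icc (0:ℝ) 1, (Ico ((j:ℝ)/(K:ℝ)) (((j:ℝ)+1)/(K:ℝ))).indicator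
      (fun x => g (x - ((j:ℝ) + 1/2)/(K:ℝ))) x
      = ∫ x in (-(1/(2*(K:ℝ))))..(1/(2*(K:ℝ))), g x := by
  have hK : (0:ℝ) < K := by exact_mod_cast j.pos
  have hj : ((j:ℝ) + 1) ≤ K := by exact_mod_cast j.isLt
  have hsub : Ico ((j:ℝ)/(K:ℝ)) (((j:ℝ)+1)/(K:ℝ)) ⊆ Icc (0:ℝ) 1 := by
    intro x hx
    have : ((j:ℝ)+1)/(K:ℝ) ≤ 1 := by rwa [div_le_one hK]
    exact ⟨le_trans (by positivity) hx.1, by linarith [hx.2]⟩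
  rw [setIntegral_indicator measurableSet_Ico, inter_eq_right.mpr hsub,
    integral_Ico_eq_integral_Ioc, ← intervalIntegral.integral_of_le (by gcongr; linarith),
    intervalIntegral.integral_comp_sub_right]
  congr 1 <;> (field_simp; ring)

lemma measurable_bump (K : ℕ) (j : Fin K) : Measurable (bump K j) := by
  have := measurable_hatFun K
  exact Measurable.indicator (by fun_prop) measurableSet_Ico

lemma abs_bump_le {K : ℕ} (j : Fin K) (x : ℝ) : |bump K j x| ≤ 1/(4*(K:ℝ)) := by
  unfold bump
  rw [indicator_apply]
  split_ifs
  · exact abs_hatFun_le j.pos _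
  · simp

lemma integrable_bump {K : ℕ} (j : Fin K) : IntegrableOn (bump K j) (Icc 0 1) :=
  Integrable.of_bound (measurable_bump K j).aestronglyMeasurable _
    (Filter.Eventually.of_forall (abs_bump_le j))

lemma integral_bump {K : ℕ} (j : Fin K) : ∫ x in Icc (0:ℝ) 1, bump K j x = 0 := by
  unfold bump
  rw [setIntegral_indicator_bin j (hatFun K), integral_hatFun j.pos]

lemma integral_abs_bump {K : ℕ} (j : Fin K) :
    ∫ x in Icc (0:ℝ) 1, |bump K j x| = 1/(8*(K:ℝ)^2) := by
  rw [← integral_abs_hatFun j.pos, ← setIntegral_indicator_bin j (fun x => |hatFun K x|)]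
  congr 1
  ext x
  simp only [bump, indicator_apply]
  split_ifs <;> simp

lemma integral_bump_sq_le {K : ℕ} (j : Fin K) :
    ∫ x in Icc (0:ℝ) 1, bump K j x ^ 2 ≤ 1/(16*(K:ℝ)^3) := by
  have hK : (0:ℝ) < K := by exact_mod_cast j.pos
  have hcst := setIntegral_indicator_bin j (fun _ => (1/(4*(K:ℝ)))^2)
  rw [intervalIntegral.integral_const] at hcst
  have hle : ∫ x in Icc (0:ℝ) 1, bump K j x ^ 2 ≤ _ :=
    integral_mono_of_nonneg (Filter.Eventually.of_forall fun x => sq_nonneg _)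
      (((integrable_const (μ := volume.restrict (Icc (0:ℝ) 1)) ((1/(4*(K:ℝ)))^2)).indicator
        (measurableSet_Ico (a := (j:ℝ)/(K:ℝ)) (b := ((j:ℝ)+1)/(K:ℝ)))))
      (Filter.Eventually.of_forall fun x => by
        simp only [bump, indicator_apply]
        split_ifs
        · exact sq_le_sq' (by linarith [abs_le.mp (abs_hatFun_le j.pos (x - ((j:ℝ) + 1/2)/(K:ℝ)))])
            (by linarith [abs_le.mp (abs_hatFun_le j.pos (x - ((j:ℝ) + 1/2)/(K:ℝ)))])
        · simp)
  rw [hcst] at hle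
  refine hle.trans (le_of_eq ?_)
  rw [smul_eq_mul]
  field_simp
  norm_num

lemma bump_eq_zero_of_ne {K : ℕ} {i j : Fin K} (hij : i ≠ j) {x : ℝ} (hi : bump K i x ≠ 0) :
    bump K j x = 0 := by
  have hK : (0:ℝ) < K := by exact_mod_cast i.pos
  by_contra hj
  have h1 := mem_of_indicator_ne_zero hi
  have h2 := mem_of_indicator_ne_zero hj
  simp only [mem_Ico, div_le_iff₀ hK, lt_div_iff₀ hK] at h1 h2
  apply hij
  have a : (i:ℝ) < j + 1 := by linarith
  have b : (j:ℝ) < i + 1 := by linarith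
  norm_cast at a b
  ext
  omega

lemma abs_trit_le (i : Fin 3) : |trit i| ≤ 1 := by
  fin_cases i <;> norm_num [trit]

lemma hardDensityLS_ge {K : ℕ} (hK : 0 < K) (v : Fin K → Fin 3) (x : ℝ) :
    3/4 ≤ hardDensityLS K v x := by
  rw [hardDensityLS_eq]
  by_cases h : ∃ i, bump K i x ≠ 0
  · obtain ⟨i, hi⟩ := h
    rw [Finset.sum_eq_single i (fun j _ hj => by rw [bump_eq_zero_of_ne hj.symm hi, mul_zero])
      (by simp)]
    have h1 : |trit (v i) * bump K i x| ≤ 1 * (1/(4*(K:ℝ))) := by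
      rw [abs_mul]
      exact mul_le_mul (abs_trit_le _) (abs_bump_le _ _) (abs_nonneg _) zero_le_one
    have h2 : 1/(4*(K:ℝ)) ≤ 1/4 := by
      have : (1:ℝ) ≤ K := by exact_mod_cast hK
      apply one_div_le_one_div_of_le <;> linarith
    linarith [(abs_le.mp h1).1]
  · push Not at h
    simp [h]
    norm_num

lemma measurable_hardDensityLS (K : ℕ) (v : Fin K → Fin 3) : Measurable (hardDensityLS K v) := by
  have := measurable_bump K
  simp only [funext (hardDensityLS_eq K v)]
  fun_prop

lemma integrable_hardDensityLS (K : ℕ) (v : Fin K → Fin 3) :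
    IntegrableOn (hardDensityLS K v) (Icc 0 1) := by
  simp only [funext (hardDensityLS_eq K v)]
  exact (integrable_const _).add
    (integrable_finsetSum _ fun j _ => (integrable_bump j).const_mul _)

lemma integral_hardDensityLS (K : ℕ) (v : Fin K → Fin 3) :
    ∫ x in Icc (0:ℝ) 1, hardDensityLS K v x = 1 := by
  simp only [hardDensityLS_eq]
  rw [integral_add (integrable_const _)
    (integrable_finsetSum _ fun j _ => (integrable_bump j).const_mul _),
    integral_finsetSum _ fun j _ => (integrable_bump j).const_mul _]
  simp [integral_const_mul, integral_bump]

/-! ## Product measures, densities and affinity -/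

lemma pi_withDensity_ofReal {ι E : Type*} [Fintype ι] [MeasurableSpace E] (P : Measure E)
    [IsFiniteMeasure P] {f : E → ℝ} (hf0 : ∀ x, 0 ≤ f x) (hfi : Integrable f P) :
    Measure.pi (fun _ : ι => P.withDensity fun x => ENNReal.ofReal (f x))
      = (Measure.pi fun _ : ι => P).withDensity fun x => ENNReal.ofReal (∏ i, f (x i)) := by
  have : IsFiniteMeasure (P.withDensity fun x => ENNReal.ofReal (f x)) :=
    isFiniteMeasure_withDensity_ofReal hfi.2
  refine Measure.pi_eq fun s hs => ?_
  have hind : ∀ x : ι → E, (univ.pi s).indicator (fun x => ENNReal.ofReal (∏ i, f (x i))) x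
      = ENNReal.ofReal (∏ i, (s i).indicator f (x i)) := by
    intro x
    rw [indicator_apply]
    split_ifs with h
    · congr 1
      exact Finset.prod_congr rfl fun i _ => (indicator_of_mem (h i (mem_univ i)) f).symm
    · simp only [mem_univ_pi, not_forall] at h
      obtain ⟨i, hi⟩ := h
      rw [Finset.prod_eq_zero (Finset.mem_univ i) (indicator_of_notMem hi f), ENNReal.ofReal_zero]
  have hsi : ∀ i, Integrable ((s i).indicator f) P := fun i => hfi.indicator (hs i)
  have hs0 : ∀ i x, 0 ≤ (s i).indicator f x := fun i => indicator_nonneg fun x _ => hf0 x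
  rw [withDensity_apply _ (MeasurableSet.univ_pi hs), ← lintegral_indicator (.univ_pi hs),
    lintegral_congr hind, ← ofReal_integral_eq_lintegral_ofReal (Integrable.fintype_prod hsi)
      (Filter.Eventually.of_forall fun x => Finset.prod_nonneg fun i _ => hs0 i _),
    integral_fintype_prod_eq_prod,
    ENNReal.ofReal_prod_of_nonneg fun i _ => integral_nonneg (hs0 i)]
  refine Finset.prod_congr rfl fun i _ => ?_
  rw [withDensity_apply _ (hs i), ← lintegral_indicator (hs i),
    ofReal_integral_eq_lintegral_ofReal (hsi i) (Filter.Eventually.of_forall (hs0 i))]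
  refine lintegral_congr fun x => ?_
  simp only [indicator_apply]
  split_ifs <;> simp

/-- The overlap of two probability measures is at least half of their squared affinity; here the
second one has density `G ^ 2` with respect to the first one. -/
lemma sq_integral_div_two_le_integral_min {α : Type*} [MeasurableSpace α] (μ : Measure α)
    [IsProbabilityMeasure μ] {G : α → ℝ} (hG : AEStronglyMeasurable G μ)
    (hG1 : ∫ x, G x ^ 2 ∂μ = 1) :
    (∫ x, G x ∂μ) ^ 2 / 2 ≤ ∫ x, min 1 (G x ^ 2) ∂μ := by
  have hGi : Integrable (fun x => G x ^ 2) μ := integrable_of_integral_eq_one hG1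
  have hi : Integrable G μ := ((memLp_two_iff_integrable_sq hG).2 hGi).integrable one_le_two
  set A := ∫ x, G x ∂μ with hA
  have hGi' : Integrable (fun x => 1 + G x ^ 2) μ := (integrable_const _).add hGi
  have hlow : ∫ x, (A * G x - A ^ 2 / 4 * (1 + G x ^ 2)) ∂μ = A ^ 2 / 2 := by
    rw [integral_sub (hi.const_mul _) (hGi'.const_mul _),
      integral_const_mul, integral_const_mul, integral_add (integrable_const _) hGi, hG1, ← hA]
    simp
    ring
  rw [← hlow]
  refine integral_mono ((hi.const_mul _).sub (hGi'.const_mul _))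
    ((integrable_const _).inf hGi) fun x => le_min ?_ ?_
  · nlinarith [sq_nonneg (A * G x / 2 - 1), sq_nonneg A]
  · nlinarith [sq_nonneg (A / 2 - G x), mul_nonneg (sq_nonneg A) (sq_nonneg (G x))]

lemma integral_min_rnDeriv {α : Type*} [MeasurableSpace α] {μ ν : Measure α} [IsFiniteMeasure μ]
    [IsFiniteMeasure ν] (hμν : μ ≪ ν) {R : α → ℝ} (hR : Measurable R) (hR0 : ∀ x, 0 ≤ R x) :
    ∫ x, min (μ.rnDeriv ν x).toReal
      ((μ.withDensity fun x => ENNReal.ofReal (R x)).rnDeriv ν x).toReal ∂ν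
      = ∫ x, min 1 (R x) ∂μ := by
  rw [← integral_toReal_rnDeriv_mul hμν]
  refine integral_congr_ae ?_
  filter_upwards [Measure.rnDeriv_withDensity_left (μ := μ) (ν := ν)
    (f := fun x => ENNReal.ofReal (R x)) hR.ennreal_ofReal.aemeasurable
    (Filter.Eventually.of_forall fun x => ENNReal.ofReal_ne_top)] with x hx
  rw [hx, ENNReal.toReal_mul, ENNReal.toReal_ofReal (hR0 x),
    mul_min_of_nonneg _ _ ENNReal.toReal_nonneg, mul_one, mul_comm (R x)]

/-! ## Labelled measures -/

lemma integral_labelMeasure {p : ℝ → ℝ} (hp : Measurable p) (hp0 : ∀ x, 0 ≤ p x) (y : Bool)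
    {f : ℝ × Bool → ℝ} (hf : Measurable f) :
    ∫ z, f z ∂labelMeasure p y = ∫ x in Icc (0:ℝ) 1, p x * f (x, y) := by
  unfold labelMeasure
  rw [integral_map (by fun_prop) hf.aestronglyMeasurable,
    integral_withDensity_eq_integral_toReal_smul hp.ennreal_ofReal
      (Filter.Eventually.of_forall fun x => ENNReal.ofReal_lt_top)]
  simp only [ENNReal.toReal_ofReal (hp0 _), smul_eq_mul]

lemma isProbabilityMeasure_labelMeasure {p : ℝ → ℝ} (hp0 : ∀ x, 0 ≤ p x)
    (hpi : IntegrableOn p (Icc 0 1)) (hp1 : ∫ x in Icc (0:ℝ) 1, p x = 1) (y : Bool) :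
    IsProbabilityMeasure (labelMeasure p y) := by
  have : IsProbabilityMeasure
      ((volume.restrict (Icc (0:ℝ) 1)).withDensity fun x => ENNReal.ofReal (p x)) := by
    constructor
    rw [withDensity_apply _ .univ, Measure.restrict_univ, ← ofReal_integral_eq_lintegral_ofReal hpi
      (Filter.Eventually.of_forall hp0), hp1, ENNReal.ofReal_one]
  exact Measure.isProbabilityMeasure_map (by fun_prop)

lemma labelMeasure_eq_withDensity {p q : ℝ → ℝ} (hp : Measurable p) (hq : Measurable q)
    (hp0 : ∀ x, 0 < p x) (y : Bool) :
    labelMeasure q y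
      = (labelMeasure p y).withDensity fun z => ENNReal.ofReal (q z.1 / p z.1) := by
  have hpm := hp.ennreal_ofReal
  have hqm := hq.ennreal_ofReal
  refine Measure.ext_of_lintegral _ fun f hf => ?_
  rw [lintegral_withDensity_eq_lintegral_mul _ (by fun_prop) hf]
  unfold labelMeasure
  rw [lintegral_map hf (by fun_prop), lintegral_map (by fun_prop) (by fun_prop),
    lintegral_withDensity_eq_lintegral_mul _ hqm (by fun_prop),
    lintegral_withDensity_eq_lintegral_mul _ hpm (by fun_prop)]
  refine lintegral_congr fun x => ?_
  simp only [Pi.mul_apply]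
  rw [← mul_assoc, ← ENNReal.ofReal_mul (hp0 x).le, mul_div_cancel₀ _ (hp0 x).ne']

lemma hardDensityLS_pos {K : ℕ} (hK : 0 < K) (v : Fin K → Fin 3) (x : ℝ) :
    0 < hardDensityLS K v x := by
  linarith [hardDensityLS_ge hK v x]

lemma isProbabilityMeasure_label_hardDensityLS {K : ℕ} (hK : 0 < K) (v : Fin K → Fin 3)
    (y : Bool) : IsProbabilityMeasure (labelMeasure (hardDensityLS K v) y) :=
  isProbabilityMeasure_labelMeasure (fun x => (hardDensityLS_pos hK v x).le)
    (integrable_hardDensityLS K v) (integral_hardDensityLS K v) y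

lemma isProbabilityMeasure_hardLSMeasure {K : ℕ} (hK : 0 < K) (nmaj nmin : ℕ) (v : TritPair K) :
    IsProbabilityMeasure (hardLSMeasure K nmaj nmin v) := by
  have := isProbabilityMeasure_label_hardDensityLS hK v.1 true
  have := isProbabilityMeasure_label_hardDensityLS hK v.2 false
  unfold hardLSMeasure sampleMeasure
  infer_instance

/-- The square root of the likelihood ratio of one minority sample. -/
def sqrtRatio (K : ℕ) (b b' : Fin K → Fin 3) (z : ℝ × Bool) : ℝ :=
  √(hardDensityLS K b' z.1 / hardDensityLS K b z.1)

lemma measurable_sqrtRatio (K : ℕ) (b b' : Fin K → Fin 3) : Measurable (sqrtRatio K b b') := by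
  have := measurable_hardDensityLS K
  unfold sqrtRatio
  fun_prop

lemma sqrtRatio_sq {K : ℕ} (hK : 0 < K) (b b' : Fin K → Fin 3) (z : ℝ × Bool) :
    sqrtRatio K b b' z ^ 2 = hardDensityLS K b' z.1 / hardDensityLS K b z.1 :=
  Real.sq_sqrt (div_nonneg (hardDensityLS_pos hK b' _).le (hardDensityLS_pos hK b _).le)

lemma integral_sqrtRatio_sq {K : ℕ} (hK : 0 < K) (b b' : Fin K → Fin 3) :
    ∫ z, sqrtRatio K b b' z ^ 2 ∂labelMeasure (hardDensityLS K b) false = 1 := by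
  rw [integral_labelMeasure (measurable_hardDensityLS K b)
    (fun x => (hardDensityLS_pos hK b x).le) _ ((measurable_sqrtRatio K b b').pow_const 2)]
  refine Eq.trans ?_ (integral_hardDensityLS K b')
  refine integral_congr_ae (Filter.Eventually.of_forall fun x => ?_)
  simp only [sqrtRatio_sq hK]
  exact mul_div_cancel₀ _ (hardDensityLS_pos hK b x).ne'

lemma integrable_sqrtRatio_sq {K : ℕ} (hK : 0 < K) (b b' : Fin K → Fin 3) :
    Integrable (fun z => sqrtRatio K b b' z ^ 2) (labelMeasure (hardDensityLS K b) false) :=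
  integrable_of_integral_eq_one (integral_sqrtRatio_sq hK b b')

lemma sub_sq_div_six_le_mul_sqrt_div {p q : ℝ} (hp : 3/4 ≤ p) (hq : 3/4 ≤ q) :
    (p + q) / 2 - (p - q) ^ 2 / 6 ≤ p * √(q / p) := by
  have ha : 0 < √p := Real.sqrt_pos.2 (by linarith)
  have hb : 0 < √q := Real.sqrt_pos.2 (by linarith)
  have ha2 : √p ^ 2 = p := Real.sq_sqrt (by linarith)
  have hb2 : √q ^ 2 = q := Real.sq_sqrt (by linarith)
  have hab : 3/4 ≤ √p * √q := by
    rw [← Real.sqrt_mul (by linarith)]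
    exact Real.le_sqrt_of_sq_le (by nlinarith)
  have h : p * √(q / p) = √p * √q := by
    rw [Real.sqrt_div (by linarith)]
    nth_rw 1 [← ha2]
    field_simp
  have hsum : 3 ≤ (√p + √q) ^ 2 := by nlinarith
  rw [h]
  have hd : (p - q) ^ 2 = (√p - √q) ^ 2 * (√p + √q) ^ 2 := by
    nth_rw 1 [← ha2, ← hb2]
    ring
  rw [hd]
  nlinarith [mul_le_mul_of_nonneg_left hsum (sq_nonneg (√p - √q))]

lemma one_sub_le_integral_sqrtRatio {K : ℕ} {b b' : Fin K → Fin 3} {j : Fin K}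
    (hb : ∀ i, i ≠ j → b i = b' i) :
    1 - 1/(24*(K:ℝ)^3) ≤ ∫ z, sqrtRatio K b b' z ∂labelMeasure (hardDensityLS K b) false := by
  have hK := j.pos
  have hdiff : ∀ x, hardDensityLS K b x - hardDensityLS K b' x
      = (trit (b j) - trit (b' j)) * bump K j x := by
    intro x
    rw [hardDensityLS_eq, hardDensityLS_eq, add_sub_add_left_eq_sub, ← Finset.sum_sub_distrib,
      Finset.sum_eq_single j]
    · ring
    · intro i _ hi
      rw [hb i hi, sub_self]
    · simp
  have hsq : ∀ x, (hardDensityLS K b x - hardDensityLS K b' x) ^ 2 ≤ 4 * bump K j x ^ 2 := by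
    intro x
    rw [hdiff, mul_pow]
    have h1 := abs_le.mp (abs_trit_le (b j))
    have h2 := abs_le.mp (abs_trit_le (b' j))
    exact mul_le_mul_of_nonneg_right (by nlinarith) (sq_nonneg _)
  have hbint : IntegrableOn (fun x => bump K j x ^ 2) (Icc 0 1) :=
    Integrable.of_bound ((measurable_bump K j).pow_const 2).aestronglyMeasurable
      ((1/(4*(K:ℝ)))^2) (Filter.Eventually.of_forall fun x => by
        rw [norm_pow, Real.norm_eq_abs]
        exact pow_le_pow_left₀ (abs_nonneg _) (abs_bump_le j x) 2)
  have hb1 := integrable_hardDensityLS K b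
  have hb2 := integrable_hardDensityLS K b'
  have hb12 : IntegrableOn (fun x => (hardDensityLS K b x + hardDensityLS K b' x) / 2)
      (Icc 0 1) := (hb1.add hb2).div_const 2
  rw [integral_labelMeasure (measurable_hardDensityLS K b)
    (fun x => (hardDensityLS_pos hK b x).le) _ (measurable_sqrtRatio K b b')]
  have hlow : ∫ x in Icc (0:ℝ) 1, ((hardDensityLS K b x + hardDensityLS K b' x) / 2
      - 2/3 * bump K j x ^ 2) = 1 - 2/3 * ∫ x in Icc (0:ℝ) 1, bump K j x ^ 2 := by
    rw [integral_sub hb12 (hbint.const_mul _), integral_div,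
      integral_add hb1 hb2, integral_hardDensityLS, integral_hardDensityLS, integral_const_mul]
    norm_num
  have hfin : IntegrableOn
      (fun x => hardDensityLS K b x * sqrtRatio K b b' (x, false)) (Icc 0 1) := by
    refine (hb1.add hb2).mono' ?_ (Filter.Eventually.of_forall fun x => ?_)
    · exact ((measurable_hardDensityLS K b).mul
        ((measurable_sqrtRatio K b b').comp (by fun_prop))).aestronglyMeasurable
    · have h1 := hardDensityLS_pos hK b x
      have h2 := hardDensityLS_pos hK b' x
      have hs := sqrtRatio_sq hK b b' (x, false)
      have hs0 : 0 ≤ sqrtRatio K b b' (x, false) := Real.sqrt_nonneg _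
      rw [eq_div_iff h1.ne'] at hs
      rw [Real.norm_of_nonneg (mul_nonneg h1.le hs0), Pi.add_apply]
      dsimp only at hs
      nlinarith [mul_nonneg h1.le (sq_nonneg (sqrtRatio K b b' (x, false) - 1)),
        mul_nonneg h1.le hs0]
  have hmono := integral_mono (hb12.sub (hbint.const_mul (2/3))) hfin
    fun x => by
      have := sub_sq_div_six_le_mul_sqrt_div (hardDensityLS_ge hK b x) (hardDensityLS_ge hK b' x)
      have h4 := hsq x
      simp only [Pi.sub_apply, sqrtRatio]
      linarith
  simp only [Pi.sub_apply] at hmono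
  rw [hlow] at hmono
  have hsqint := integral_bump_sq_le j
  have : (1:ℝ)/(24*(K:ℝ)^3) = 2/3 * (1/(16*(K:ℝ)^3)) := by field_simp; norm_num
  linarith

lemma exp_neg_le_pow {K : ℕ} (hK : 0 < K) (n : ℕ) :
    Real.exp (-(n:ℝ)/(3*(K:ℝ)^3)) ≤ ((1 - 1/(24*(K:ℝ)^3)) ^ n) ^ 2 := by
  have hK' : (1:ℝ) ≤ K := by exact_mod_cast hK
  have hK3 : (1:ℝ) ≤ (K:ℝ)^3 := one_le_pow₀ hK'
  set t := 1/(24*(K:ℝ)^3) with ht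
  have ht0 : 0 < t := by positivity
  have ht1 : t ≤ 1/24 := one_div_le_one_div_of_le (by norm_num) (by linarith)
  have h : Real.exp (-(4*t)) ≤ 1 - t := by
    rw [Real.exp_neg, inv_le_iff_one_le_mul₀ (Real.exp_pos _)]
    nlinarith [Real.add_one_le_exp (4*t)]
  have : Real.exp (-(n:ℝ)/(3*(K:ℝ)^3)) = (Real.exp (-(4*t)) ^ n) ^ 2 := by
    rw [← Real.exp_nat_mul, ← Real.exp_nat_mul, ht]
    congr 1
    push_cast
    field_simp
    ring
  rw [this]
  gcongr

/-! ## The posterior -/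

lemma hardLSMeasure_eq_withDensity {K : ℕ} (hK : 0 < K) (nmaj nmin : ℕ) (a b b' : Fin K → Fin 3) :
    hardLSMeasure K nmaj nmin (a, b') = (hardLSMeasure K nmaj nmin (a, b)).withDensity
      fun S => ENNReal.ofReal ((∏ i, sqrtRatio K b b' (S.2 i)) ^ 2) := by
  have := isProbabilityMeasure_label_hardDensityLS hK a true
  have := isProbabilityMeasure_label_hardDensityLS hK b false
  have := measurable_sqrtRatio K b b'
  unfold hardLSMeasure sampleMeasure
  dsimp only
  rw [labelMeasure_eq_withDensity (measurable_hardDensityLS K b) (measurable_hardDensityLS K b')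
    (hardDensityLS_pos hK b)]
  simp only [← sqrtRatio_sq hK]
  rw [pi_withDensity_ofReal _ (fun z => sq_nonneg _) (integrable_sqrtRatio_sq hK b b'),
    prod_withDensity_right (by fun_prop)]
  simp only [Finset.prod_pow]

lemma exp_div_two_le_integral_min_one {K : ℕ} (nmaj nmin : ℕ) (a : Fin K → Fin 3)
    {b b' : Fin K → Fin 3} {j : Fin K} (hb : ∀ i, i ≠ j → b i = b' i) :
    Real.exp (-(nmin:ℝ)/(3*(K:ℝ)^3)) / 2
      ≤ ∫ S, min 1 ((∏ i, sqrtRatio K b b' (S.2 i)) ^ 2) ∂hardLSMeasure K nmaj nmin (a, b) := by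
  have hK := j.pos
  have := isProbabilityMeasure_label_hardDensityLS hK a true
  have := isProbabilityMeasure_label_hardDensityLS hK b false
  have := isProbabilityMeasure_hardLSMeasure hK nmaj nmin (a, b)
  have hm := measurable_sqrtRatio K b b'
  have hsnd : ∀ f : (Fin nmin → ℝ × Bool) → ℝ,
      ∫ S, f S.2 ∂hardLSMeasure K nmaj nmin (a, b)
        = ∫ s, f s ∂Measure.pi fun _ : Fin nmin => labelMeasure (hardDensityLS K b) false := by
    intro f
    unfold hardLSMeasure sampleMeasure
    rw [integral_fun_snd, probReal_univ, one_smul]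
  have hG := hsnd fun s => ∏ i, sqrtRatio K b b' (s i)
  have hG1 := hsnd fun s => ∏ i, sqrtRatio K b b' (s i) ^ 2
  rw [integral_fintype_prod_eq_pow, Fintype.card_fin] at hG
  rw [integral_fintype_prod_eq_pow (fun z => sqrtRatio K b b' z ^ 2), integral_sqrtRatio_sq hK,
    one_pow] at hG1
  simp only [Finset.prod_pow] at hG1
  refine le_trans ?_ (sq_integral_div_two_le_integral_min _
    (G := fun S : Sample nmaj nmin => ∏ i, sqrtRatio K b b' (S.2 i))
    (Measurable.aestronglyMeasurable (by fun_prop)) hG1)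
  rw [hG]
  have h0 : 0 ≤ 1 - 1/(24*(K:ℝ)^3) := by
    have hK' : (1:ℝ) ≤ K := by exact_mod_cast hK
    have hK3 : (1:ℝ) ≤ (K:ℝ)^3 := one_le_pow₀ hK'
    rw [sub_nonneg, div_le_one (by positivity)]
    linarith
  have h := one_sub_le_integral_sqrtRatio hb
  refine div_le_div_of_nonneg_right ((exp_neg_le_pow hK nmin).trans ?_) zero_le_two
  gcongr

lemma card_tritPair_ne_zero (K : ℕ) : (Fintype.card (TritPair K) : ℝ≥0∞) ≠ 0 :=
  Nat.cast_ne_zero.2 Fintype.card_ne_zero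

lemma isFiniteMeasure_joint {K : ℕ} (hK : 0 < K) (nmaj nmin : ℕ) (v : TritPair K) :
    IsFiniteMeasure ((Fintype.card (TritPair K) : ℝ≥0∞)⁻¹ • hardLSMeasure K nmaj nmin v) :=
  have := isProbabilityMeasure_hardLSMeasure hK nmaj nmin v
  Measure.smul_finite _ (ENNReal.inv_ne_top.2 (card_tritPair_ne_zero K))

lemma isFiniteMeasure_hardLSMarginal {K : ℕ} (hK : 0 < K) (nmaj nmin : ℕ) :
    IsFiniteMeasure (hardLSMarginal K nmaj nmin) := by
  have := isFiniteMeasure_joint hK nmaj nmin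
  unfold hardLSMarginal
  infer_instance

lemma joint_absolutelyContinuous (K nmaj nmin : ℕ) (v : TritPair K) :
    (Fintype.card (TritPair K) : ℝ≥0∞)⁻¹ • hardLSMeasure K nmaj nmin v
      ≪ hardLSMarginal K nmaj nmin := by
  intro s hs
  simp only [hardLSMarginal, Measure.coe_finsetSum, Finset.sum_apply, Finset.sum_eq_zero_iff] at hs
  exact hs v (Finset.mem_univ v)

lemma postLS_nonneg (K nmaj nmin : ℕ) (v : TritPair K) (S : Sample nmaj nmin) :
    0 ≤ postLS K nmaj nmin v S :=
  ENNReal.toReal_nonneg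

lemma integrable_postLS {K : ℕ} (hK : 0 < K) (nmaj nmin : ℕ) (v : TritPair K) :
    Integrable (postLS K nmaj nmin v) (hardLSMarginal K nmaj nmin) :=
  have := isFiniteMeasure_joint hK nmaj nmin v
  Measure.integrable_toReal_rnDeriv

lemma integral_postLS {K : ℕ} (hK : 0 < K) (nmaj nmin : ℕ) (v : TritPair K) :
    ∫ S, postLS K nmaj nmin v S ∂hardLSMarginal K nmaj nmin
      = (Fintype.card (TritPair K) : ℝ)⁻¹ := by
  have := isFiniteMeasure_joint hK nmaj nmin v
  have := isFiniteMeasure_hardLSMarginal hK nmaj nmin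
  have := isProbabilityMeasure_hardLSMeasure hK nmaj nmin v
  have h := Measure.integral_toReal_rnDeriv (joint_absolutelyContinuous K nmaj nmin v)
  refine h.trans ?_
  rw [measureReal_ennreal_smul_apply, probReal_univ, ENNReal.toReal_inv, ENNReal.toReal_natCast,
    mul_one]

lemma le_integral_min_postLS {K : ℕ} (nmaj nmin : ℕ) (a : Fin K → Fin 3)
    {b b' : Fin K → Fin 3} {j : Fin K} (hb : ∀ i, i ≠ j → b i = b' i) :
    (Fintype.card (TritPair K) : ℝ)⁻¹ * (Real.exp (-(nmin:ℝ)/(3*(K:ℝ)^3)) / 2)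
      ≤ ∫ S, min (postLS K nmaj nmin (a, b) S) (postLS K nmaj nmin (a, b') S)
        ∂hardLSMarginal K nmaj nmin := by
  have hK := j.pos
  have := isFiniteMeasure_joint hK nmaj nmin (a, b)
  have := isFiniteMeasure_hardLSMarginal hK nmaj nmin
  have hm := measurable_sqrtRatio K b b'
  have h := integral_min_rnDeriv (joint_absolutelyContinuous K nmaj nmin (a, b))
    (R := fun S => (∏ i, sqrtRatio K b b' (S.2 i)) ^ 2) (by fun_prop) (fun S => sq_nonneg _)
  rw [withDensity_smul_measure, ← hardLSMeasure_eq_withDensity hK, integral_smul_measure,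
    ENNReal.toReal_inv, ENNReal.toReal_natCast, smul_eq_mul] at h
  unfold postLS
  rw [h]
  exact mul_le_mul_of_nonneg_left (exp_div_two_le_integral_min_one nmaj nmin a hb) (by positivity)

/-! ## Reduction of the total variation distance to the bins -/

/-- The posterior expectation of the difference of the two coordinates in the `j`-th bin. -/
def postDiff (K nmaj nmin : ℕ) (S : Sample nmaj nmin) (j : Fin K) : ℝ :=
  ∑ v : TritPair K, postLS K nmaj nmin v S * (trit (v.1 j) - trit (v.2 j))

lemma postMixLS_sub (K nmaj nmin : ℕ) (S : Sample nmaj nmin) (x : ℝ) :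
    postMixLS K nmaj nmin S true x - postMixLS K nmaj nmin S false x
      = ∑ j, postDiff K nmaj nmin S j * bump K j x := by
  simp only [postMixLS, postDiff, hardDensityLS_eq, Finset.sum_mul, if_true]
  rw [Finset.sum_comm, ← Finset.sum_sub_distrib]
  refine Finset.sum_congr rfl fun v _ => ?_
  rw [← mul_sub, if_neg Bool.false_ne_true, add_sub_add_left_eq_sub, ← Finset.sum_sub_distrib,
    Finset.mul_sum]
  exact Finset.sum_congr rfl fun j _ => by ring

lemma tvDist_postMixLS_le {K : ℕ} (nmaj nmin : ℕ) (S : Sample nmaj nmin) :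
    tvDist (postMixLS K nmaj nmin S true) (postMixLS K nmaj nmin S false)
      ≤ 1/(16*(K:ℝ)^2) * ∑ j, |postDiff K nmaj nmin S j| := by
  unfold tvDist
  have hi : ∀ j ∈ Finset.univ, IntegrableOn
      (fun x => |postDiff K nmaj nmin S j| * |bump K j x|) (Icc 0 1) :=
    fun j _ => (integrable_bump j).abs.const_mul _
  have h : ∫ x in Icc (0:ℝ) 1,
      |postMixLS K nmaj nmin S true x - postMixLS K nmaj nmin S false x| ≤ _ :=
    integral_mono_of_nonneg (Filter.Eventually.of_forall fun x => abs_nonneg _)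
      (integrable_finsetSum _ hi) (Filter.Eventually.of_forall fun x => by
        simp only [postMixLS_sub, ← abs_mul]
        exact Finset.abs_sum_le_sum_abs _ _)
  rw [integral_finsetSum _ hi] at h
  simp only [integral_const_mul, integral_abs_bump, ← Finset.sum_mul] at h
  calc _ ≤ (1/2) * _ := mul_le_mul_of_nonneg_left h (by norm_num)
    _ = _ := by ring

/-- The reflection of the `j`-th coordinate of the minority index. -/
def flipAt {K : ℕ} (j : Fin K) (b : Fin K → Fin 3) : Fin K → Fin 3 :=
  Function.update b j (b j).rev

lemma flipAt_flipAt {K : ℕ} (j : Fin K) (b : Fin K → Fin 3) : flipAt j (flipAt j b) = b := by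
  simp [flipAt]

lemma trit_rev (i : Fin 3) : trit i.rev = -trit i := by
  fin_cases i <;> norm_num [trit, Fin.rev]

/-- Cancellation between the indices with vanishing majority coordinate and opposite
minority coordinates. -/
lemma abs_sum_mul_sub_trit_le {K : ℕ} (j : Fin K) {p : TritPair K → ℝ} (hp : ∀ v, 0 ≤ p v) :
    |∑ v, p v * (trit (v.1 j) - trit (v.2 j))|
      ≤ ∑ v, p v * |trit (v.1 j) - trit (v.2 j)|
        - ∑ v, (if v.1 j = 1 ∧ v.2 j ≠ 1 then 1 else 0) * min (p v) (p (v.1, flipAt j v.2)) := by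
  set m : TritPair K → ℝ := fun v =>
    (if v.1 j = 1 ∧ v.2 j ≠ 1 then 1 else 0) * min (p v) (p (v.1, flipAt j v.2)) with hm
  set D : TritPair K → ℝ := fun v => trit (v.1 j) - trit (v.2 j) with hD
  have hmp : ∀ v, m v ≤ p v := by
    intro v
    simp only [hm]
    split_ifs
    · simp
    · simpa using hp v
  have hmD : ∀ v, m v * |D v| = m v := by
    intro v
    simp only [hm, hD]
    split_ifs with h
    · obtain ⟨h1, h2⟩ := h
      rw [h1]
      generalize v.2 j = i at h2
      fin_cases i <;> first | exact absurd rfl h2 | norm_num [trit]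
    · simp
  let σ : TritPair K ≃ TritPair K :=
    ⟨fun v => (v.1, flipAt j v.2), fun v => (v.1, flipAt j v.2),
      fun v => by simp [flipAt_flipAt], fun v => by simp [flipAt_flipAt]⟩
  have hanti : ∀ v, m (σ v) * D (σ v) = -(m v * D v) := by
    intro v
    have hσ : (flipAt j v.2) j = (v.2 j).rev := by simp [flipAt]
    have hrev : (v.2 j).rev = 1 ↔ v.2 j = 1 := by
      generalize v.2 j = i
      fin_cases i <;> decide
    simp only [hm, hD, σ, Equiv.coe_fn_mk, flipAt_flipAt, hσ, trit_rev, ne_eq, hrev,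
      min_comm (p (v.1, flipAt j v.2))]
    split_ifs with h
    · rw [h.1]
      norm_num [trit]
      ring
    · simp
  have hzero : ∑ v, m v * D v = 0 := by
    have h := Equiv.sum_comp σ fun v => m v * D v
    simp only [hanti, Finset.sum_neg_distrib] at h
    linarith
  calc |∑ v, p v * D v| = |∑ v, (p v - m v) * D v| := by
        simp only [sub_mul, Finset.sum_sub_distrib, hzero, sub_zero]
    _ ≤ ∑ v, |(p v - m v) * D v| := Finset.abs_sum_le_sum_abs _ _
    _ = ∑ v, (p v * |D v| - m v) := by
        refine Finset.sum_congr rfl fun v _ => ?_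
        rw [abs_mul, abs_of_nonneg (sub_nonneg.2 (hmp v)), sub_mul, hmD]
    _ = _ := Finset.sum_sub_distrib _ _

lemma sum_apply_eq {K : ℕ} (j : Fin K) (f : Fin 3 → ℝ) :
    3 * ∑ a : Fin K → Fin 3, f (a j) = Fintype.card (Fin K → Fin 3) * ∑ i, f i := by
  have h := Fintype.card_congr (Equiv.funSplitAt j (Fin 3))
  have h' : ∑ a : Fin K → Fin 3, f (a j)
      = ∑ q : Fin 3 × ({i // i ≠ j} → Fin 3), f q.1 :=
    Fintype.sum_equiv (Equiv.funSplitAt j (Fin 3)) _ _ fun a => rfl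
  rw [h, h', Fintype.sum_prod_type, Fintype.card_prod]
  simp only [Finset.sum_const, Finset.card_univ, nsmul_eq_mul, ← Finset.mul_sum, Fintype.card_fin]
  push_cast
  ring

lemma sum_tritPair_eq {K : ℕ} (j : Fin K) (f : Fin 3 → Fin 3 → ℝ) :
    ∑ v : TritPair K, f (v.1 j) (v.2 j)
      = Fintype.card (TritPair K) * ((∑ i, ∑ k, f i k) / 9) := by
  have h1 : ∀ i, ∑ b : Fin K → Fin 3, f i (b j)
      = Fintype.card (Fin K → Fin 3) * (∑ k, f i k) / 3 := fun i => by
    linarith [sum_apply_eq j (f i)]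
  have h2 := sum_apply_eq j fun i => ∑ k, f i k
  rw [Fintype.sum_prod_type, Fintype.card_prod]
  simp only [h1, ← Finset.sum_div, ← Finset.mul_sum]
  push_cast
  linear_combination (Fintype.card (Fin K → Fin 3) : ℝ) / 9 * h2

lemma integrable_min_postLS {K : ℕ} (hK : 0 < K) (nmaj nmin : ℕ) (v w : TritPair K) :
    Integrable (fun S => min (postLS K nmaj nmin v S) (postLS K nmaj nmin w S))
      (hardLSMarginal K nmaj nmin) :=
  (integrable_postLS hK nmaj nmin v).inf (integrable_postLS hK nmaj nmin w)

lemma integral_abs_postDiff_le {K : ℕ} (nmaj nmin : ℕ) (j : Fin K) :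
    ∫ S, |postDiff K nmaj nmin S j| ∂hardLSMarginal K nmaj nmin
      ≤ 8/9 - 1/9 * Real.exp (-(nmin:ℝ)/(3*(K:ℝ)^3)) := by
  have hK := j.pos
  have hi1 : ∀ v ∈ (Finset.univ : Finset (TritPair K)), Integrable
      (fun S => postLS K nmaj nmin v S * |trit (v.1 j) - trit (v.2 j)|)
      (hardLSMarginal K nmaj nmin) :=
    fun v _ => (integrable_postLS hK nmaj nmin v).mul_const _
  have hi2 : ∀ v ∈ (Finset.univ : Finset (TritPair K)), Integrable
      (fun S => (if v.1 j = 1 ∧ v.2 j ≠ 1 then (1:ℝ) else 0) *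
        min (postLS K nmaj nmin v S) (postLS K nmaj nmin (v.1, flipAt j v.2) S))
      (hardLSMarginal K nmaj nmin) :=
    fun v _ => (integrable_min_postLS hK nmaj nmin v _).const_mul _
  have h : ∫ S, |postDiff K nmaj nmin S j| ∂hardLSMarginal K nmaj nmin ≤ _ :=
    integral_mono_of_nonneg (Filter.Eventually.of_forall fun S => abs_nonneg _)
      ((integrable_finsetSum _ hi1).sub (integrable_finsetSum _ hi2))
      (Filter.Eventually.of_forall fun S =>
        abs_sum_mul_sub_trit_le j fun v => postLS_nonneg K nmaj nmin v S)
  refine h.trans ?_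
  simp only [Pi.sub_apply]
  rw [integral_sub (integrable_finsetSum _ hi1) (integrable_finsetSum _ hi2),
    integral_finsetSum _ hi1, integral_finsetSum _ hi2]
  simp only [integral_mul_const, integral_const_mul, integral_postLS hK]
  have hcard : (Fintype.card (TritPair K) : ℝ) ≠ 0 := Nat.cast_ne_zero.2 Fintype.card_ne_zero
  set E := Real.exp (-(nmin:ℝ)/(3*(K:ℝ)^3)) with hE
  have hlow : ∑ v : TritPair K, (if v.1 j = 1 ∧ v.2 j ≠ 1 then (1:ℝ) else 0) *
      ((Fintype.card (TritPair K) : ℝ)⁻¹ * (E / 2))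
      ≤ ∑ v : TritPair K, (if v.1 j = 1 ∧ v.2 j ≠ 1 then (1:ℝ) else 0) *
        ∫ S, min (postLS K nmaj nmin v S) (postLS K nmaj nmin (v.1, flipAt j v.2) S)
          ∂hardLSMarginal K nmaj nmin := by
    refine Finset.sum_le_sum fun v _ => mul_le_mul_of_nonneg_left
      (le_integral_min_postLS nmaj nmin v.1 (j := j) fun i hi => ?_) (by split_ifs <;> norm_num)
    simp [flipAt, hi]
  rw [← Finset.sum_mul,
    sum_tritPair_eq j fun i k => if i = 1 ∧ k ≠ 1 then (1:ℝ) else 0] at hlow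
  rw [← Finset.mul_sum, sum_tritPair_eq j fun i k => |trit i - trit k|]
  have s1 : ∑ i, ∑ k, |trit i - trit k| = 8 := by
    simp [Fin.sum_univ_three, trit]
    norm_num
  have s2 : ∑ i : Fin 3, ∑ k : Fin 3, (if i = 1 ∧ k ≠ 1 then (1:ℝ) else 0) = 2 := by
    have h01 : (0 : Fin 3) ≠ 1 := by decide
    have h21 : (2 : Fin 3) ≠ 1 := by decide
    simp only [Fin.sum_univ_three, h01, h21, ne_eq, not_true, not_false_iff, and_true, and_false,
      if_true, if_false]
    norm_num
  rw [s2, show (Fintype.card (TritPair K) : ℝ) * (2/9) *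
    ((Fintype.card (TritPair K) : ℝ)⁻¹ * (E / 2)) = 1/9 * E by field_simp] at hlow
  rw [s1, inv_mul_cancel_left₀ hcard]
  linarith

/-- **Lemma (posterior TV bound for the hard label-shift family).** If `V` is uniform on
`𝒱 = {-1,0,1}^K × {-1,0,1}^K` and `S | V = v ~ P_{v,maj}^{n_maj} × P_{v,min}^{n_min}`, then
`E_{S ~ Q_S}[TV(Σ_v Q(v|S) P_{v,1}, Σ_v Q(v|S) P_{v,-1})]
  ≤ 1/(18K) - (1/(144K)) exp(-n_min/(3K³))`. -/
theorem label_shift_posterior_tv_bound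
    (K nmaj nmin : ℕ) (hK : 0 < K) (hmin : 1 ≤ nmin) (hmaj : nmin < nmaj) :
    (∫ S, tvDist (postMixLS K nmaj nmin S true) (postMixLS K nmaj nmin S false)
        ∂hardLSMarginal K nmaj nmin)
      ≤ 1/(18*(K:ℝ)) - (1/(144*(K:ℝ))) * Real.exp (-(nmin : ℝ)/(3*(K:ℝ)^3)) := by
  have hcoef : (0:ℝ) ≤ 1/(16*(K:ℝ)^2) := by positivity
  have hi : ∀ j ∈ (Finset.univ : Finset (Fin K)), Integrable
      (fun S => |postDiff K nmaj nmin S j|) (hardLSMarginal K nmaj nmin) := fun j _ =>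
    (integrable_finsetSum _ fun v _ => (integrable_postLS hK nmaj nmin v).mul_const _).abs
  have h : ∫ S, tvDist (postMixLS K nmaj nmin S true) (postMixLS K nmaj nmin S false)
      ∂hardLSMarginal K nmaj nmin ≤ _ :=
    integral_mono_of_nonneg
      (Filter.Eventually.of_forall fun S =>
        mul_nonneg (by norm_num) (integral_nonneg fun x => abs_nonneg _))
      ((integrable_finsetSum _ hi).const_mul _)
      (Filter.Eventually.of_forall fun S => tvDist_postMixLS_le nmaj nmin S)
  rw [integral_const_mul, integral_finsetSum _ hi] at h
  refine h.trans ((mul_le_mul_of_nonneg_left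
    (Finset.sum_le_sum fun j _ => integral_abs_postDiff_le nmaj nmin j) hcoef).trans (le_of_eq ?_))
  rw [Finset.sum_const, Finset.card_univ, Fintype.card_fin, nsmul_eq_mul]
  have hK' : (K:ℝ) ≠ 0 := by exact_mod_cast hK.ne'
  generalize Real.exp _ = E
  field_simp
  ring
end
end

section
/- For the hard label-shift family, with V = (V_1, V_{−1}) drawn uniformly from {−1,0,1}^K × {−1,0,1}^K, the expected total variation distance between the two class-conditional densities satisfies E_V[ TV(P_{V,1}, P_{V,−1}) ] = 1/(18K). -/
open MeasureTheory Set
open scoped ENNReal Classical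

noncomputable section

/-- The two-bump profile `a - ||y| - a|`, which is `|φ_K|` on a bin when `a = 1/(4K)`. -/
def absHatProfile (a y : ℝ) : ℝ := a - |(|y| - a)|

lemma continuous_absHatProfile (a : ℝ) : Continuous (absHatProfile a) := by
  unfold absHatProfile; fun_prop

lemma abs_hatFun (K : ℕ) (hK : 0 < K) {x : ℝ} (hx : |x| ≤ 1 / (2 * (K : ℝ))) :
    |hatFun K x| = absHatProfile (1 / (4 * (K : ℝ))) x := by
  have hK' : (0 : ℝ) < K := by exact_mod_cast hK
  have ha : (0 : ℝ) < 1 / (4 * (K : ℝ)) := by positivity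
  have h2 : 1 / (2 * (K : ℝ)) = 2 * (1 / (4 * (K : ℝ))) := by field_simp; norm_num
  unfold hatFun absHatProfile
  rw [h2] at hx ⊢
  generalize 1 / (4 * (K : ℝ)) = a at *
  obtain ⟨hl, hr⟩ := abs_le.1 hx
  rcases le_or_gt x 0 with h0 | h0
  · rw [if_pos ⟨hl, h0⟩, abs_of_nonpos h0,
      abs_of_nonpos (sub_nonpos.2 (abs_le.2 ⟨by linarith, by linarith⟩)),
      show -x - a = -(x + a) by ring, abs_neg]
    ring
  · rw [if_neg (fun h => absurd h.2 (not_le.2 h0)), if_pos ⟨h0.le, hr⟩, abs_of_pos h0,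
      abs_of_nonneg (sub_nonneg.2 (abs_le.2 ⟨by linarith, by linarith⟩))]

lemma integral_absHatProfile {a : ℝ} (ha : 0 ≤ a) :
    ∫ y in (-(2 * a))..(2 * a), absHatProfile a y = 2 * a ^ 2 := by
  have hint (b c : ℝ) : IntervalIntegrable (absHatProfile a) volume b c :=
    (continuous_absHatProfile a).intervalIntegrable b c
  have hpos : ∫ y in (0 : ℝ)..(2 * a), absHatProfile a y = a ^ 2 := by
    rw [← intervalIntegral.integral_add_adjacent_intervals (hint 0 a) (hint a (2 * a)),
      intervalIntegral.integral_congr (g := fun y => y),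
      intervalIntegral.integral_congr (a := a) (g := fun y => 2 * a - y)]
    · rw [intervalIntegral.integral_sub (by simp) (by simp)]
      simp
      ring
    · intro y hy
      rw [uIcc_of_le (by linarith)] at hy
      simp only [absHatProfile]
      rw [abs_of_nonneg (ha.trans hy.1), abs_of_nonneg (sub_nonneg.2 hy.1)]
      ring
    · intro y hy
      rw [uIcc_of_le ha] at hy
      simp only [absHatProfile]
      rw [abs_of_nonneg hy.1, abs_of_nonpos (sub_nonpos.2 hy.2)]
      ring
  have hneg : ∫ y in (-(2 * a))..0, absHatProfile a y = a ^ 2 := by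
    have h := intervalIntegral.integral_comp_neg (a := 0) (b := 2 * a) (absHatProfile a)
    rw [neg_zero] at h
    rw [← h, ← hpos]
    simp [absHatProfile]
  rw [← intervalIntegral.integral_add_adjacent_intervals (hint _ 0) (hint 0 _), hpos, hneg]
  ring

lemma eq_of_mem_bins {K : ℕ} (hK : 0 < K) {x : ℝ} {i j : Fin K}
    (hi : x ∈ Ico ((i : ℝ) / (K : ℝ)) (((i : ℝ) + 1) / (K : ℝ)))
    (hj : x ∈ Ico ((j : ℝ) / (K : ℝ)) (((j : ℝ) + 1) / (K : ℝ))) : i = j := by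
  have hK' : (0 : ℝ) < K := by exact_mod_cast hK
  have h1 : (i : ℝ) < (j : ℝ) + 1 := (div_lt_div_iff_of_pos_right hK').1 (hi.1.trans_lt hj.2)
  have h2 : (j : ℝ) < (i : ℝ) + 1 := (div_lt_div_iff_of_pos_right hK').1 (hj.1.trans_lt hi.2)
  norm_cast at h1 h2
  exact Fin.ext (by omega)

lemma abs_sub_hardDensityLS {K : ℕ} (hK : 0 < K) (v w : Fin K → Fin 3) (x : ℝ) :
    |hardDensityLS K v x - hardDensityLS K w x| =
      ∑ j : Fin K, (Ico ((j : ℝ) / (K : ℝ)) (((j : ℝ) + 1) / (K : ℝ))).indicator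
        (fun x => |trit (v j) - trit (w j)| *
          absHatProfile (1 / (4 * (K : ℝ))) (x - ((j : ℝ) + 1 / 2) / (K : ℝ))) x := by
  have hK' : (0 : ℝ) < K := by exact_mod_cast hK
  unfold hardDensityLS
  rw [add_sub_add_left_eq_sub, ← Finset.sum_sub_distrib]
  by_cases h : ∃ j : Fin K, x ∈ Ico ((j : ℝ) / (K : ℝ)) (((j : ℝ) + 1) / (K : ℝ))
  · obtain ⟨j, hj⟩ := h
    have hne (i : Fin K) (hij : i ≠ j) :
        x ∉ Ico ((i : ℝ) / (K : ℝ)) (((i : ℝ) + 1) / (K : ℝ)) :=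
      fun hi => hij (eq_of_mem_bins hK hi hj)
    rw [Finset.sum_eq_single_of_mem j (Finset.mem_univ j)
        (fun i _ hij => by rw [if_neg (hne i hij), if_neg (hne i hij), sub_zero]),
      Finset.sum_eq_single_of_mem j (Finset.mem_univ j)
        (fun i _ hij => indicator_of_notMem (hne i hij) _),
      if_pos hj, if_pos hj, indicator_of_mem hj, ← sub_mul, abs_mul, abs_hatFun K hK]
    have h1 : ((j : ℝ) + 1 / 2) / (K : ℝ) = (j : ℝ) / K + 1 / (2 * K) := by field_simp
    have h2 : ((j : ℝ) + 1) / (K : ℝ) = (j : ℝ) / K + 2 * (1 / (2 * K)) := by field_simp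
    have h3 := hj.1
    have h4 := hj.2
    rw [h2] at h4
    rw [h1, abs_le]
    constructor <;> linarith
  · push Not at h
    rw [Finset.sum_eq_zero (fun j _ => by rw [if_neg (h j), if_neg (h j), sub_zero]),
      Finset.sum_eq_zero (fun j _ => indicator_of_notMem (h j) _), abs_zero]

lemma tvDist_hardDensityLS {K : ℕ} (hK : 0 < K) (v w : Fin K → Fin 3) :
    tvDist (hardDensityLS K v) (hardDensityLS K w) =
      1 / (16 * (K : ℝ) ^ 2) * ∑ j : Fin K, |trit (v j) - trit (w j)| := by
  have hK' : (0 : ℝ) < K := by exact_mod_cast hK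
  unfold tvDist
  simp_rw [abs_sub_hardDensityLS hK]
  rw [integral_finsetSum]
  · have hbin (j : Fin K) : ∫ x in Icc (0 : ℝ) 1,
        (Ico ((j : ℝ) / (K : ℝ)) (((j : ℝ) + 1) / (K : ℝ))).indicator
          (fun x => |trit (v j) - trit (w j)| *
            absHatProfile (1 / (4 * (K : ℝ))) (x - ((j : ℝ) + 1 / 2) / (K : ℝ))) x =
        |trit (v j) - trit (w j)| * (1 / (8 * (K : ℝ) ^ 2)) := by
      have hsub : Ico ((j : ℝ) / (K : ℝ)) (((j : ℝ) + 1) / (K : ℝ)) ⊆ Icc 0 1 := by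
        refine Ico_subset_Icc_self.trans (Icc_subset_Icc (by positivity) ?_)
        rw [div_le_one hK']
        exact_mod_cast j.2
      rw [setIntegral_indicator measurableSet_Ico, inter_eq_self_of_subset_right hsub,
        integral_const_mul, integral_Ico_eq_integral_Ioc,
        ← intervalIntegral.integral_of_le (by gcongr; linarith),
        intervalIntegral.integral_comp_sub_right (absHatProfile (1 / (4 * (K : ℝ)))),
        show (j : ℝ) / K - ((j : ℝ) + 1 / 2) / K = -(2 * (1 / (4 * (K : ℝ)))) by
          field_simp; ring,
        show ((j : ℝ) + 1) / K - ((j : ℝ) + 1 / 2) / K = 2 * (1 / (4 * (K : ℝ))) by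
          field_simp; ring,
        integral_absHatProfile (by positivity)]
      congr 1
      field_simp
      norm_num
    simp_rw [hbin]
    rw [← Finset.sum_mul]
    field_simp
    ring
  · intro j _
    refine Integrable.indicator (Continuous.integrableOn_Icc ?_) measurableSet_Ico
    exact continuous_const.mul
      ((continuous_absHatProfile _).comp (continuous_id.sub continuous_const))

lemma sum_abs_trit_sub : ∑ a : Fin 3, ∑ b : Fin 3, |trit a - trit b| = 8 := by
  simp only [Fin.sum_univ_three, trit]
  norm_num

lemma sum_tritPair_abs_sub {K : ℕ} (j : Fin K) :
    9 * ∑ v : TritPair K, |trit (v.1 j) - trit (v.2 j)| =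
      8 * (Fintype.card (TritPair K) : ℝ) := by
  have hsum (g : Fin 3 → ℝ) : ∑ f : Fin K → Fin 3, g (f j) = 3 ^ (K - 1) * ∑ a, g a := by
    have h := Fintype.sum_piFinset_apply g (Finset.univ : Finset (Fin 3)) j
    simpa using h
  obtain ⟨n, rfl⟩ : ∃ n, K = n + 1 := ⟨K - 1, by have := j.2; omega⟩
  rw [Fintype.sum_prod_type,
    Finset.sum_congr rfl fun f _ => hsum fun b => |trit (f j) - trit b|,
    ← Finset.mul_sum, hsum fun a => ∑ b, |trit a - trit b|, sum_abs_trit_sub]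
  simp
  ring

/-- **Lemma.** For the hard label-shift family, with `V = (V₁, V₋₁)` drawn uniformly from
`{-1,0,1}^K × {-1,0,1}^K`, the expected total variation distance between the two
class-conditional densities is `E_V[TV(P_{V,1}, P_{V,-1})] = 1/(18K)`. -/
theorem expected_tv_hard_family (K : ℕ) (hK : 0 < K) :
    (∑ v : TritPair K, tvDist (hardDensityLS K v.1) (hardDensityLS K v.2)) /
        (Fintype.card (TritPair K) : ℝ) = 1/(18*(K:ℝ)) := by
  have hK' : (0 : ℝ) < K := by exact_mod_cast hK
  have hcard : (Fintype.card (TritPair K) : ℝ) ≠ 0 := by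
    exact_mod_cast Fintype.card_ne_zero
  have hcoord (j : Fin K) : ∑ v : TritPair K, |trit (v.1 j) - trit (v.2 j)| =
      8 / 9 * (Fintype.card (TritPair K) : ℝ) := by
    linarith [sum_tritPair_abs_sub j]
  simp_rw [tvDist_hardDensityLS hK]
  rw [← Finset.mul_sum, Finset.sum_comm, Finset.sum_congr rfl fun j _ => hcoord j,
    Finset.sum_const, Finset.card_univ, Fintype.card_fin, nsmul_eq_mul]
  field_simp
  norm_num
end
end
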